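/- arXiv:1103.3437 — 2 statements merged into one kernel-verified Lean document; each statement's English description precedes it below -/
import Mathlib

section
/- Let b be an element of the crystal B^{⊗N} (tensor powers of the standard gl(n)-crystal of letters {1,...,n}) with f_1 b ≠ 0 and ē_1(f_1 b) = 0. Then ē_1 b = 0. -/
/-!
The `gl(n)`-crystal `𝐁 = {1, …, n}` of the vector representation and its tensor
powers `𝐁^{⊗N}`, realized concretely on words (lists) of letters.  Letters are
`0`-based: the natural number `a` stands for the letter `a+1`, so the letters of
`𝐁` are `0, 1, …, n-1`, and the operator index `i` (`0`-based, standing for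
`i+1 ∈ {1, …, n-1}`) acts on the letters `i, i+1`.  A list `[a₁, …, a_N]`
stands for the tensor `a₁ ⊗ ⋯ ⊗ a_N`.
-/

namespace QWord

/-- `e i` on a single letter. -/
def eL (i a : ℕ) : Option ℕ := if a = i + 1 then some i else none

/-- `f i` on a single letter. -/
def fL (i a : ℕ) : Option ℕ := if a = i then some (i + 1) else none

/-- `φ i` of a single letter. -/
def phiL (i a : ℕ) : ℕ := if a = i then 1 else 0

/-- `ε i` of a single letter. -/
def epsL (i a : ℕ) : ℕ := if a = i + 1 then 1 else 0

/-- `ε i` of a word, via `ε(b₁ ⊗ b₂) = max (ε(b₁), ε(b₂) - ⟨hᵢ, wt b₁⟩)`. -/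
def epsW (i : ℕ) : List ℕ → ℕ
  | [] => 0
  | a :: w => max (epsL i a) (epsW i w + epsL i a - phiL i a)

/-- `φ i` of a word, via `φ(b₁ ⊗ b₂) = max (φ(b₂), φ(b₁) + ⟨hᵢ, wt b₂⟩)`. -/
def phiW (i : ℕ) : List ℕ → ℕ
  | [] => 0
  | a :: w => max (phiW i w) (phiL i a + w.count i - w.count (i + 1))

/-- The even Kashiwara operator `e i` on words (the tensor product rule:
`e(b₁ ⊗ b₂) = e b₁ ⊗ b₂` if `φ(b₁) ≥ ε(b₂)`, else `b₁ ⊗ e b₂`). -/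
def eW (i : ℕ) : List ℕ → Option (List ℕ)
  | [] => none
  | a :: w =>
    if epsW i w ≤ phiL i a then (eL i a).map (· :: w)
    else (eW i w).map (a :: ·)

/-- The even Kashiwara operator `f i` on words (the tensor product rule:
`f(b₁ ⊗ b₂) = f b₁ ⊗ b₂` if `φ(b₁) > ε(b₂)`, else `b₁ ⊗ f b₂`). -/
def fW (i : ℕ) : List ℕ → Option (List ℕ)
  | [] => none
  | a :: w =>
    if epsW i w < phiL i a then (fL i a).map (· :: w)
    else (fW i w).map (a :: ·)

/-- The odd Kashiwara operator `ē₁` on words: by the odd tensor product rule it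
acts on the rightmost letter of the word lying in `{1, 2}` (here `{0, 1}`), and
is nonzero exactly when that letter is `2` (here `1`), turning it into `1`
(here `0`). -/
def ebarW : List ℕ → Option (List ℕ)
  | [] => none
  | a :: w =>
    if w.count 0 = 0 ∧ w.count 1 = 0 then
      (if a = 1 then some 0 else none).map (· :: w)
    else (ebarW w).map (a :: ·)

/-- The odd Kashiwara operator `f̄₁` on words. -/
def fbarW : List ℕ → Option (List ℕ)
  | [] => none
  | a :: w =>
    if w.count 0 = 0 ∧ w.count 1 = 0 then
      (if a = 0 then some 1 else none).map (· :: w)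
    else (fbarW w).map (a :: ·)

/-- Iterate a partial operator. -/
def iterOpt (g : List ℕ → Option (List ℕ)) : ℕ → List ℕ → Option (List ℕ)
  | 0, b => some b
  | k + 1, b => (g b).bind (iterOpt g k)

/-- The Weyl group reflection `Sᵢ b = fᵢ^{⟨hᵢ, wt b⟩} b` if `⟨hᵢ, wt b⟩ ≥ 0`
and `eᵢ^{-⟨hᵢ, wt b⟩} b` otherwise; note `⟨hᵢ, wt b⟩` is
`count i - count (i+1)` for a word. -/
def SiW (i : ℕ) (b : List ℕ) : Option (List ℕ) :=
  if b.count (i + 1) ≤ b.count i then iterOpt (fW i) (b.count i - b.count (i + 1)) b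
  else iterOpt (eW i) (b.count (i + 1) - b.count i) b

/-- `applySeq [j₁, …, j_k] b = (S_{j₁} ∘ ⋯ ∘ S_{j_k}) b`. -/
def applySeq : List ℕ → List ℕ → Option (List ℕ)
  | [], b => some b
  | j :: t, b => (applySeq t b).bind (SiW j)

/-- The reduced word (`0`-based list of simple reflections) of
`w_i = s₂ ⋯ s_i s₁ ⋯ s_{i-1}`, for the `1`-based index `i`. -/
def wiList (i : ℕ) : List ℕ := (List.range (i - 1)).map (· + 1) ++ List.range (i - 1)

/-- The odd operator `ē_i = S_{w_i}⁻¹ ∘ ē₁ ∘ S_{w_i}` on words; here `i` is the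
`0`-based index (so `ebarWi 0 = ē₁`, up to the trivial conjugation). -/
def ebarWi (i : ℕ) (b : List ℕ) : Option (List ℕ) :=
  ((applySeq (wiList (i + 1)) b).bind ebarW).bind (applySeq (wiList (i + 1)).reverse)

end QWord

open QWord

/-- If `f₁` acts on a word, the word contains the letter `1` and its image the letter `2`
(these are the letters `0` and `1` in the `0`-based encoding). -/
theorem QWord.count_pos_of_fW {b b' : List ℕ} (h : fW 0 b = some b') :
    0 < b.count 0 ∧ 0 < b'.count 1 := by
  induction b generalizing b' with
  | nil => simp [fW] at h
  | cons a w ih =>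
    rw [fW] at h
    split_ifs at h with hc
    · by_cases ha : a = 0
      · simp [fL, ha] at h
        subst h ha
        simp
      · simp [phiL, ha] at hc
    · obtain ⟨w', hw, rfl⟩ := Option.map_eq_some_iff.mp h
      obtain ⟨h0, h1⟩ := ih hw
      simp only [List.count_cons]
      omega

/-- if `b ∈ 𝐁^{⊗N}` satisfies `f₁ b ≠ 0` and `ē₁ (f₁ b) = 0`,
then `ē₁ b = 0`. -/
theorem stmt_8 (b b' : List ℕ) (h1 : fW 0 b = some b') (h2 : ebarW b' = none) :
    ebarW b = none := by
  induction b generalizing b' with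
  | nil => rfl
  | cons a w ih =>
    rw [fW] at h1
    split_ifs at h1 with hc
    · by_cases ha : a = 0
      · simp only [fL, ha, if_true, Option.map_some, Option.some.injEq] at h1
        subst h1 ha
        rw [ebarW] at h2 ⊢
        split_ifs at h2 ⊢ with hw <;> simp_all
      · simp [phiL, ha] at hc
    · obtain ⟨w', hw, rfl⟩ := Option.map_eq_some_iff.mp h1
      obtain ⟨hpos, hpos'⟩ := count_pos_of_fW hw
      rw [ebarW, if_neg (by omega), Option.map_eq_none_iff] at h2 ⊢
      exact ih w' hw h2
end

section
/- Let b be a word in B^{⊗N} with ē_1 b = 0, e_1 b = 0, and such that the number of 1's in b exceeds the number of 2's in b by at least 2. Then ē_1(1 ⊗ f_1 b) = 0 in B^{⊗(N+1)}. -/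
open QWord

namespace QWord

theorem epsW_eq_zero_of_eW_eq_none {i : ℕ} {b : List ℕ} (h : eW i b = none) :
    epsW i b = 0 := by
  induction b with
  | nil => rfl
  | cons a w ih =>
    simp only [eW, eL, epsW, epsL, phiL] at *
    split_ifs at h ⊢ <;> simp_all

theorem ebarW_eq_none_of_count_eq_zero {b : List ℕ} (h0 : b.count 0 = 0)
    (h1 : b.count 1 = 0) : ebarW b = none := by
  cases b with
  | nil => rfl
  | cons a w =>
    simp only [List.count_cons] at h0 h1
    simp_all [ebarW]

theorem ebarW_tail_eq_none {a : ℕ} {w : List ℕ} (h : ebarW (a :: w) = none) :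
    ebarW w = none := by
  by_cases hw : w.count 0 = 0 ∧ w.count 1 = 0
  · exact ebarW_eq_none_of_count_eq_zero hw.1 hw.2
  · simpa only [ebarW, if_neg hw, Option.map_eq_none_iff] using h

theorem ebarW_cons_eq_none {a : ℕ} {w : List ℕ} (hw : 0 < w.count 0 + w.count 1)
    (h : ebarW w = none) : ebarW (a :: w) = none := by
  rw [ebarW, if_neg (by omega), h, Option.map_none]

theorem count_pos_of_fW_eq_some {i : ℕ} {b b' : List ℕ} (h : fW i b = some b') :
    0 < b'.count (i + 1) := by
  induction b generalizing b' with
  | nil => simp [fW] at h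
  | cons a w ih =>
    rw [fW] at h
    split_ifs at h
    · simp only [fL, Option.map_eq_some_iff] at h
      obtain ⟨c, hc, rfl⟩ := h
      split_ifs at hc
      simp_all
    · obtain ⟨w', hw', rfl⟩ := Option.map_eq_some_iff.1 h
      have := ih hw'
      rw [List.count_cons]
      omega

/-- If `b` has at least two unbracketed letters `1` (the number of these is
`#1 - #2 + ε₁`), then applying `f₁` preserves the vanishing of `ē₁`. -/
theorem ebarW_eq_none_of_fW_eq_some {b b' : List ℕ} (h0 : ebarW b = none)
    (h2 : b.count 1 + 2 ≤ b.count 0 + epsW 0 b) (hf : fW 0 b = some b') :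
    ebarW b' = none := by
  induction b generalizing b' with
  | nil => simp [fW] at hf
  | cons a w ih =>
    have hw := ebarW_tail_eq_none h0
    simp only [List.count_cons, epsW, epsL, phiL, beq_iff_eq] at h2
    simp only [fW, phiL] at hf
    split_ifs at hf with ha hlt hlt
    · subst ha
      simp only [fL, if_true, Option.map_some, Option.some.injEq] at hf
      subst hf
      refine ebarW_cons_eq_none ?_ hw
      simp at h2
      omega
    · obtain ⟨w', hw', rfl⟩ := Option.map_eq_some_iff.1 hf
      have hc : 0 < w'.count 1 := count_pos_of_fW_eq_some hw'
      refine ebarW_cons_eq_none (by omega) (ih hw ?_ hw')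
      simp [ha] at h2
      omega
    · omega
    · obtain ⟨w', hw', rfl⟩ := Option.map_eq_some_iff.1 hf
      have hc : 0 < w'.count 1 := count_pos_of_fW_eq_some hw'
      refine ebarW_cons_eq_none (by omega) (ih hw ?_ hw')
      split_ifs at h2 <;> omega

end QWord

/-- if a word `b` satisfies `ē₁ b = 0`, `e₁ b = 0` and the number
of `1`'s exceeds the number of `2`'s by at least `2` (letters `0` and `1` in the
`0`-based encoding), then `ē₁ (1 ⊗ f₁ b) = 0`. -/
theorem stmt_11 (b b' : List ℕ) (h0 : ebarW b = none) (h1 : eW 0 b = none)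
    (h2 : b.count 1 + 2 ≤ b.count 0) (hf : fW 0 b = some b') :
    ebarW (0 :: b') = none := by
  have hc : 0 < b'.count 1 := count_pos_of_fW_eq_some hf
  have he := epsW_eq_zero_of_eW_eq_none h1
  exact ebarW_cons_eq_none (by omega)
    (ebarW_eq_none_of_fW_eq_some h0 (by omega) hf)
end
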